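/- arXiv:1910.04417 — 2 statements merged into one kernel-verified Lean document; each statement's English description precedes it below -/
import Mathlib

section
/- Let S and A be finite nonempty types, T : S × A → PMF S a Markov kernel, and μπ, μE probability mass functions on S × A with μπ absolutely continuous with respect to μE. Since the Kullback–Leibler divergence of the inverse dynamics conditionals is nonnegative, the naive LfO objective is bounded above by the LfD objective: D_KL(ρπ(s,s') ‖ ρE(s,s')) ≤ D_KL(μπ ‖ μE), where ρπ(s,s') and ρE(s,s') are the state-transition marginals of the induced joint distributions ρ(s,a,s') = μ(s,a)·T(s,a)(s'). -/
open scoped BigOperators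

/-- Kullback–Leibler divergence: `D_KL(p ‖ q) = Σ_x p(x)·log(p(x)/q(x))`,
with terms where `p x = 0` equal to `0`. -/
noncomputable def klDiv {X : Type*} [Fintype X] (p q : X → ℝ) : ℝ :=
  ∑ x, p x * Real.log (p x / q x)

/-- The real-valued mass function of a `PMF`. -/
noncomputable def pmfReal {X : Type*} (μ : PMF X) : X → ℝ := fun x => (μ x).toReal

/-- The joint distribution on `S × A × S` induced by a state-action occupancy
measure `μ` and a Markov kernel `T`: `ρ(s,a,s') = μ(s,a) · T(s,a)(s')`. -/
noncomputable def joint {S A : Type*} (T : S × A → PMF S) (μ : PMF (S × A)) :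
    S × A × S → ℝ :=
  fun x => (μ (x.1, x.2.1)).toReal * ((T (x.1, x.2.1)) x.2.2).toReal

/-- The state-transition marginal `ρ(s,s') = Σ_a ρ(s,a,s')`. -/
noncomputable def transMarg {S A : Type*} [Fintype A]
    (T : S × A → PMF S) (μ : PMF (S × A)) : S × S → ℝ :=
  fun p => ∑ a : A, joint T μ (p.1, a, p.2)

/-- The log-sum inequality. -/
theorem sum_mul_log_sum_div_sum_le {ι : Type*} (s : Finset ι) (p q : ι → ℝ)
    (hp : ∀ i ∈ s, 0 ≤ p i) (hq : ∀ i ∈ s, 0 ≤ q i)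
    (hpq : ∀ i ∈ s, 0 < p i → 0 < q i) :
    (∑ i ∈ s, p i) * Real.log ((∑ i ∈ s, p i) / ∑ i ∈ s, q i) ≤
      ∑ i ∈ s, p i * Real.log (p i / q i) := by
  set P := ∑ i ∈ s, p i with hP
  set Q := ∑ i ∈ s, q i with hQ
  rcases (Finset.sum_nonneg hp).eq_or_lt with h0 | hpos
  · have hz := (Finset.sum_eq_zero_iff_of_nonneg hp).1 h0.symm
    rw [hP, ← h0, zero_mul, Finset.sum_eq_zero]
    intro i hi
    rw [hz i hi, zero_mul]
  have hPpos : 0 < P := hpos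
  have hQpos : 0 < Q := by
    obtain ⟨i, hi, hip⟩ := (Finset.sum_pos_iff_of_nonneg hp).1 hpos
    exact (Finset.sum_pos_iff_of_nonneg hq).2 ⟨i, hi, hpq i hi hip⟩
  have key : ∀ i ∈ s,
      p i * Real.log (P / Q) + (p i - q i * (P / Q)) ≤ p i * Real.log (p i / q i) := by
    intro i hi
    rcases (hp i hi).eq_or_lt with h | h
    · have := mul_nonneg (hq i hi) (div_pos hPpos hQpos).le
      simp only [← h]
      linarith
    · have hqi := hpq i hi h
      have h1 := Real.one_sub_inv_le_log_of_pos
        (div_pos (div_pos h hqi) (div_pos hPpos hQpos))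
      rw [Real.log_div (div_pos h hqi).ne' (div_pos hPpos hQpos).ne'] at h1
      have h2 := mul_le_mul_of_nonneg_left h1 h.le
      have h3 : p i * (1 - (p i / q i / (P / Q))⁻¹) = p i - q i * (P / Q) := by
        field_simp
      linarith
  have hsum := Finset.sum_le_sum key
  rw [Finset.sum_add_distrib, Finset.sum_sub_distrib, ← Finset.sum_mul, ← Finset.sum_mul,
    ← hP, ← hQ, mul_div_cancel₀ P hQpos.ne'] at hsum
  linarith

theorem PMF.sum_toReal_eq_one {X : Type*} [Fintype X] (μ : PMF X) :
    ∑ x, (μ x).toReal = 1 := by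
  rw [← ENNReal.toReal_sum fun x _ => μ.apply_ne_top x, ← tsum_fintype (L := .unconditional X),
    μ.tsum_coe, ENNReal.toReal_one]

/-- The naive LfO objective is bounded above by the LfD objective:
`D_KL(ρπ(s,s') ‖ ρE(s,s')) ≤ D_KL(μπ ‖ μE)`. -/
theorem kl_transMarg_le_kl_stateAction {S A : Type*}
    [Fintype S] [Fintype A] [Nonempty S] [Nonempty A]
    (T : S × A → PMF S) (μπ μE : PMF (S × A))
    (hac : ∀ x : S × A, 0 < μπ x → 0 < μE x) :
    klDiv (transMarg T μπ) (transMarg T μE) ≤ klDiv (pmfReal μπ) (pmfReal μE) := by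
  have hpos : ∀ x, 0 < (μπ x).toReal → 0 < (μE x).toReal := fun x hx =>
    ENNReal.toReal_pos (hac x (ENNReal.toReal_pos_iff.1 hx).1).ne' (μE.apply_ne_top x)
  have hlocal : ∀ s s', transMarg T μπ (s, s') *
        Real.log (transMarg T μπ (s, s') / transMarg T μE (s, s')) ≤
      ∑ a, (μπ (s, a)).toReal * Real.log ((μπ (s, a)).toReal / (μE (s, a)).toReal) *
        (T (s, a) s').toReal := by
    intro s s'
    refine (sum_mul_log_sum_div_sum_le Finset.univ
      (fun a => joint T μπ (s, a, s')) (fun a => joint T μE (s, a, s'))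
      (fun a _ => mul_nonneg ENNReal.toReal_nonneg ENNReal.toReal_nonneg)
      (fun a _ => mul_nonneg ENNReal.toReal_nonneg ENNReal.toReal_nonneg) ?_).trans_eq ?_
    · intro a _ h
      have hT := pos_of_mul_pos_right h ENNReal.toReal_nonneg
      exact mul_pos (hpos _ (pos_of_mul_pos_left h hT.le)) hT
    · refine Finset.sum_congr rfl fun a _ => ?_
      simp only [joint]
      rcases eq_or_ne (T (s, a) s').toReal 0 with h | h
      · simp [h]
      · rw [mul_div_mul_right _ _ h]
        ring
  simp only [klDiv, pmfReal, Fintype.sum_prod_type]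
  refine Finset.sum_le_sum fun s _ => (Finset.sum_le_sum fun s' _ => hlocal s s').trans_eq ?_
  rw [Finset.sum_comm]
  simp only [← Finset.mul_sum, PMF.sum_toReal_eq_one, mul_one]
end

section
/- Let S and A be finite nonempty types, T : S × A → PMF S a Markov kernel, and μπ, μE probability mass functions on S × A with μπ absolutely continuous with respect to μE. Suppose D_KL(ρπ(s,s') ‖ ρE(s,s')) = 0 for the state-transition marginals of the induced joint distributions. Then the inverse dynamics disagreement is bounded above by a negative entropy plus a constant independent of μπ: D_KL(ρπ(a|s,s') ‖ ρE(a|s,s')) ≤ −H(μπ) + C, where H(μπ) = −Σ_{(s,a)} μπ(s,a)·log μπ(s,a) and C = max over (s,a) with μE(s,a) > 0 of (−log μE(s,a)). -/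
open scoped BigOperators

/-- Entropy of a probability mass function: `H(μ) = −Σ_x μ(x)·log μ(x)`. -/
noncomputable def entropy {X : Type*} [Fintype X] (p : X → ℝ) : ℝ :=
  -∑ x, p x * Real.log (p x)

/-- The inverse dynamics conditional `ρ(a|s,s') = ρ(s,a,s') / ρ(s,s')`,
meaningful whenever `ρ(s,s') > 0`. -/
noncomputable def invCond {S A : Type*} [Fintype A]
    (T : S × A → PMF S) (μ : PMF (S × A)) : S × A × S → ℝ :=
  fun x => joint T μ x / transMarg T μ (x.1, x.2.2)

/-- The inverse dynamics disagreement
`Σ_{(s,a,s')} ρπ(s,a,s')·log(ρπ(a|s,s')/ρE(a|s,s'))`. -/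
noncomputable def invDynDisagreement {S A : Type*} [Fintype S] [Fintype A]
    (T : S × A → PMF S) (μπ μE : PMF (S × A)) : ℝ :=
  ∑ x : S × A × S, joint T μπ x * Real.log (invCond T μπ x / invCond T μE x)

theorem joint_nonneg {S A : Type*} (T : S × A → PMF S) (μ : PMF (S × A)) (x : S × A × S) :
    0 ≤ joint T μ x :=
  mul_nonneg ENNReal.toReal_nonneg ENNReal.toReal_nonneg

theorem joint_le_transMarg {S A : Type*} [Fintype A] (T : S × A → PMF S) (μ : PMF (S × A))
    (s : S) (a : A) (s' : S) : joint T μ (s, a, s') ≤ transMarg T μ (s, s') :=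
  Finset.single_le_sum (f := fun a => joint T μ (s, a, s'))
    (fun _ _ => joint_nonneg T μ _) (Finset.mem_univ a)

theorem PMF.sum_toReal {X : Type*} [Fintype X] (p : PMF X) : ∑ x, (p x).toReal = 1 := by
  rw [← ENNReal.toReal_sum fun x _ => p.apply_ne_top x, ← tsum_fintype (L := .unconditional X),
    p.tsum_coe, ENNReal.toReal_one]

theorem PMF.toReal_pos {X : Type*} (p : PMF X) {x : X} (h : 0 < p x) : 0 < (p x).toReal :=
  ENNReal.toReal_pos h.ne' (p.apply_ne_top x)

theorem joint_mul_log_invCond_div {S A : Type*} [Fintype A]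
    (T : S × A → PMF S) (μπ μE : PMF (S × A)) (hac : ∀ x : S × A, 0 < μπ x → 0 < μE x)
    (s : S) (a : A) (s' : S) :
    joint T μπ (s, a, s') *
        Real.log (invCond T μπ (s, a, s') / invCond T μE (s, a, s')) =
      joint T μπ (s, a, s') * Real.log (pmfReal μπ (s, a) / pmfReal μE (s, a)) -
        joint T μπ (s, a, s') * Real.log (transMarg T μπ (s, s') / transMarg T μE (s, s')) := by
  rcases eq_or_ne (joint T μπ (s, a, s')) 0 with h0 | h0
  · simp [h0]
  have hμ : (μπ (s, a)).toReal ≠ 0 := left_ne_zero_of_mul h0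
  have hT : (T (s, a) s').toReal ≠ 0 := right_ne_zero_of_mul h0
  have hE : (μE (s, a)).toReal ≠ 0 :=
    (μE.toReal_pos (hac _ (pos_iff_ne_zero.2 fun h => hμ (by simp [h])))).ne'
  have hjE : joint T μE (s, a, s') ≠ 0 := mul_ne_zero hE hT
  have hmπ : transMarg T μπ (s, s') ≠ 0 :=
    (((joint_nonneg T μπ _).lt_of_ne' h0).trans_le (joint_le_transMarg T μπ s a s')).ne'
  have hmE : transMarg T μE (s, s') ≠ 0 :=
    (((joint_nonneg T μE _).lt_of_ne' hjE).trans_le (joint_le_transMarg T μE s a s')).ne'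
  simp only [pmfReal]
  rw [← mul_sub, ← Real.log_div (div_ne_zero hμ hE) (div_ne_zero hmπ hmE)]
  congr 2
  simp only [invCond, joint]
  field_simp

/-- The chain rule: the inverse dynamics disagreement is the divergence of the occupancy measures
minus the divergence of the state-transition marginals. -/
theorem invDynDisagreement_eq_klDiv_sub_klDiv {S A : Type*} [Fintype S] [Fintype A]
    (T : S × A → PMF S) (μπ μE : PMF (S × A)) (hac : ∀ x : S × A, 0 < μπ x → 0 < μE x) :
    invDynDisagreement T μπ μE =
      klDiv (pmfReal μπ) (pmfReal μE) - klDiv (transMarg T μπ) (transMarg T μE) := by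
  simp only [invDynDisagreement, klDiv, Fintype.sum_prod_type,
    joint_mul_log_invCond_div T μπ μE hac, Finset.sum_sub_distrib]
  congr 1
  · refine Finset.sum_congr rfl fun s _ => Finset.sum_congr rfl fun a _ => ?_
    rw [← Finset.sum_mul]
    simp only [joint, pmfReal]
    rw [← Finset.mul_sum, PMF.sum_toReal, mul_one]
  · refine Finset.sum_congr rfl fun s _ => ?_
    rw [Finset.sum_comm]
    refine Finset.sum_congr rfl fun s' _ => ?_
    rw [← Finset.sum_mul, transMarg]

theorem klDiv_le_neg_entropy_add_sSup {X : Type*} [Fintype X] (p q : PMF X)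
    (hac : ∀ x, 0 < p x → 0 < q x) :
    klDiv (pmfReal p) (pmfReal q) ≤
      -entropy (pmfReal p) + sSup ((fun x => -Real.log (q x).toReal) '' {x | 0 < q x}) := by
  set C := sSup ((fun x => -Real.log (q x).toReal) '' {x | 0 < q x})
  have hC : ∑ x, pmfReal p x * C = C := by
    rw [← Finset.sum_mul]
    simp only [pmfReal]
    rw [PMF.sum_toReal, one_mul]
  rw [entropy, neg_neg, ← hC, ← Finset.sum_add_distrib]
  refine Finset.sum_le_sum fun x _ => ?_
  rcases eq_or_ne (p x) 0 with h0 | h0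
  · simp [pmfReal, h0]
  have hp := p.toReal_pos (pos_iff_ne_zero.2 h0)
  have hq := hac x (pos_iff_ne_zero.2 h0)
  have hle : -Real.log (q x).toReal ≤ C :=
    le_csSup (Set.toFinite _).bddAbove (Set.mem_image_of_mem _ hq)
  rw [← mul_add, pmfReal, pmfReal, Real.log_div hp.ne' (q.toReal_pos hq).ne']
  exact mul_le_mul_of_nonneg_left (by linarith) hp.le

/-- If the naive LfO objective `D_KL(ρπ(s,s') ‖ ρE(s,s'))` is zero, then the
inverse dynamics disagreement is bounded by a negative entropy plus a constant
independent of `μπ`: the maximum of `−log μE(s,a)` over the support of `μE`. -/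
theorem invDynDisagreement_le_neg_entropy_add_const {S A : Type*}
    [Fintype S] [Fintype A] [Nonempty S] [Nonempty A]
    (T : S × A → PMF S) (μπ μE : PMF (S × A))
    (hac : ∀ x : S × A, 0 < μπ x → 0 < μE x)
    (hmatch : klDiv (transMarg T μπ) (transMarg T μE) = 0) :
    invDynDisagreement T μπ μE ≤
      -entropy (pmfReal μπ) +
        sSup ((fun x : S × A => -Real.log (μE x).toReal) '' {x | 0 < μE x}) := by
  rw [invDynDisagreement_eq_klDiv_sub_klDiv T μπ μE hac, hmatch, sub_zero]
  exact klDiv_le_neg_entropy_add_sSup μπ μE hac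
end
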